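/- Let n ∈ {-1} ∪ ω, let κ be a cardinal, and suppose S ⊆ κ is such that every S-list ⟨S_α : α ∈ S⟩ has a homogeneous set which is Π^1_n-indescribable in κ (where by convention Π^1_{-1}-indescribable in κ means of cardinality κ). Then S is Π^1_{n+2}-indescribable in κ. -/

import Mathlib

namespace LCI


/-- `κ` is (the initial ordinal of) a regular uncountable cardinal. -/
def RegUncountable (kappa : Ordinal.{0}) : Prop :=
  Ordinal.omega0 < kappa ∧ kappa.cof.ord = kappa

/-- `C` is a club (closed unbounded) subset of the ordinal `κ`. -/
def IsClubIn (C : Set Ordinal.{0}) (kappa : Ordinal.{0}) : Prop :=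
  C ⊆ Set.Iio kappa ∧
  (∀ alpha < kappa, ∃ beta ∈ C, alpha < beta) ∧
  ∀ beta < kappa, beta ≠ 0 →
    (∀ gamma < beta, ∃ delta ∈ C, gamma < delta ∧ delta < beta) → beta ∈ C

/-- `S` is a stationary subset of the ordinal `κ`. -/
def IsStationaryIn (S : Set Ordinal.{0}) (kappa : Ordinal.{0}) : Prop :=
  S ⊆ Set.Iio kappa ∧ ∀ C, IsClubIn C kappa → (S ∩ C).Nonempty

/-- `H` is homogeneous for the list `L` (where `L α ⊆ α` on the relevant domain):
whenever `α < β` are both in `H`, `L α = L β ∩ α`. -/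
def Homog (L : Ordinal.{0} → Set Ordinal.{0}) (H : Set Ordinal.{0}) : Prop :=
  ∀ alpha ∈ H, ∀ beta ∈ H, alpha < beta → L alpha = L beta ∩ Set.Iio alpha

/-- `S ⊆ κ` is a subtle subset of `κ`: for every `S`-list `L` (i.e. `L α ⊆ α` for
`α ∈ S`) and every club `C ⊆ κ` there are `α < β` in `S ∩ C` with `L α = L β ∩ α`. -/
def IsSubtleIn (S : Set Ordinal.{0}) (kappa : Ordinal.{0}) : Prop :=
  S ⊆ Set.Iio kappa ∧
  ∀ L : Ordinal.{0} → Set Ordinal.{0}, (∀ alpha ∈ S, L alpha ⊆ Set.Iio alpha) →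
    ∀ C, IsClubIn C kappa →
      ∃ alpha ∈ S ∩ C, ∃ beta ∈ S ∩ C, alpha < beta ∧ L alpha = L beta ∩ Set.Iio alpha

/-- Second-order formulas over a structure `(M, ∈, A)` where `M` is a set of sets:
de Bruijn indexed first-order variables and second-order (subset) variables,
a binary membership relation, and a unary predicate for `A`. -/
inductive SOForm : Type where
  | mem : ℕ → ℕ → SOForm
  | app : ℕ → ℕ → SOForm
  | inA : ℕ → SOForm
  | not : SOForm → SOForm
  | and : SOForm → SOForm → SOForm
  | fall : SOForm → SOForm
  | sall : SOForm → SOForm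

/-- Prepend a value to a valuation (de Bruijn style). -/
def consVal {alpha : Type 1} (x : alpha) (v : ℕ → alpha) : ℕ → alpha
  | 0 => x
  | n + 1 => v n

/-- Satisfaction of a second-order formula in the structure `(M, ∈, A)`,
relative to first- and second-order valuations; first-order quantifiers range
over `M` and second-order quantifiers range over subsets of `M`. -/
def SOSat (M A : Set ZFSet.{0}) : SOForm → (ℕ → ZFSet.{0}) → (ℕ → Set ZFSet.{0}) → Prop
  | .mem i j, v, _ => v i ∈ v j
  | .app i j, v, w => v j ∈ w i
  | .inA i, v, _ => v i ∈ A
  | .not phi, v, w => ¬ SOSat M A phi v w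
  | .and phi psi, v, w => SOSat M A phi v w ∧ SOSat M A psi v w
  | .fall phi, v, w => ∀ x ∈ M, SOSat M A phi (consVal x v) w
  | .sall phi, v, w => ∀ P : Set ZFSet.{0}, P ⊆ M → SOSat M A phi v (consVal P w)

/-- A formula is first-order if it contains no second-order quantifier. -/
def SOForm.FO : SOForm → Prop
  | .not phi => phi.FO
  | .and phi psi => phi.FO ∧ psi.FO
  | .fall phi => phi.FO
  | .sall _ => False
  | _ => True

mutual
  /-- `IsPiForm n φ` : `φ` is a `Π¹ₙ` formula. -/
  inductive IsPiForm : ℕ → SOForm → Prop where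
    | fo {phi : SOForm} : phi.FO → IsPiForm 0 phi
    | up {n : ℕ} {phi : SOForm} : IsSigmaForm n phi → IsPiForm (n + 1) phi
    | all {n : ℕ} {phi : SOForm} : IsPiForm (n + 1) phi → IsPiForm (n + 1) (SOForm.sall phi)
  /-- `IsSigmaForm n φ` : `φ` is a `Σ¹ₙ` formula. -/
  inductive IsSigmaForm : ℕ → SOForm → Prop where
    | fo {phi : SOForm} : phi.FO → IsSigmaForm 0 phi
    | up {n : ℕ} {phi : SOForm} : IsPiForm n phi → IsSigmaForm (n + 1) phi
    | ex {n : ℕ} {phi : SOForm} : IsSigmaForm (n + 1) phi →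
        IsSigmaForm (n + 1) (SOForm.not (SOForm.sall (SOForm.not phi)))
end

/-- Satisfaction of a sentence: satisfaction under the default valuations. -/
def SOSatS (M A : Set ZFSet.{0}) (phi : SOForm) : Prop :=
  SOSat M A phi (fun _ => ∅) (fun _ => ∅)

/-- The rank-initial segment `V_α` of the set-theoretic universe. -/
def Vrank (alpha : Ordinal.{0}) : Set ZFSet.{0} := {x | ZFSet.rank x < alpha}

/-- `X ⊆ κ` is a `Π¹ₙ`-indescribable subset of `κ` : for every `A ⊆ V_κ` and every
`Π¹ₙ` sentence `φ`, if `(V_κ, ∈, A) ⊨ φ` then `(V_ξ, ∈, A ∩ V_ξ) ⊨ φ` for some `ξ ∈ X`. -/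
def PiIndesc (n : ℕ) (X : Set Ordinal.{0}) (kappa : Ordinal.{0}) : Prop :=
  X ⊆ Set.Iio kappa ∧
  ∀ A : Set ZFSet.{0}, A ⊆ Vrank kappa → ∀ phi : SOForm, IsPiForm n phi →
    SOSatS (Vrank kappa) A phi → ∃ xi ∈ X, SOSatS (Vrank xi) (A ∩ Vrank xi) phi

/-- `X` is a `Π¹ₙ`-indescribable subset of `κ` for `n ∈ {-1} ∪ ω` : for `n ≥ 0` this is
`Π¹ₙ`-indescribability, and by convention for `n = -1` it means `X ⊆ κ` has cardinality `κ`
(i.e. `X ∈ ([κ]^{<κ})⁺`). -/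
def PiPos (n : ℤ) (X : Set Ordinal.{0}) (kappa : Ordinal.{0}) : Prop :=
  match n with
  | Int.ofNat m => PiIndesc m X kappa
  | Int.negSucc _ => X ⊆ Set.Iio kappa ∧ Cardinal.mk ↥X = Cardinal.lift.{1} kappa.card

/-- The ideal `Π¹ₙ(κ)` of non-`Π¹ₙ`-indescribable subsets of `κ`
(with the convention `Π¹₋₁(κ) = [κ]^{<κ}`). -/
def PiIdealZ (n : ℤ) (kappa : Ordinal.{0}) : Set (Set Ordinal.{0}) :=
  {X | X ⊆ Set.Iio kappa ∧ ¬ PiPos n X kappa}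


open Cardinal Ordinal Order

/-! ### Prenex classes -/

theorem IsPiForm.of_fo {phi : SOForm} (h : phi.FO) (n : ℕ) :
    IsPiForm n phi ∧ IsSigmaForm n phi := by
  induction n with
  | zero => exact ⟨.fo h, .fo h⟩
  | succ n ih => exact ⟨.up ih.2, .up ih.1⟩

/-- Every prenex formula has an equivalent of the same complexity which moreover asserts that the
universe is nonempty. -/
theorem IsPiForm.exists_and_nonempty {n : ℕ} {phi : SOForm} (h : IsPiForm n phi) :
    ∃ psi, IsPiForm n psi ∧
      ∀ M A v w, SOSat M A psi v w ↔ SOSat M A phi v w ∧ M.Nonempty := by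
  refine IsPiForm.rec
    (motive_1 := fun n phi _ => ∃ psi, IsPiForm n psi ∧
      ∀ M A v w, SOSat M A psi v w ↔ SOSat M A phi v w ∧ M.Nonempty)
    (motive_2 := fun n phi _ => ∃ psi, IsSigmaForm n psi ∧
      ∀ M A v w, SOSat M A psi v w ↔ SOSat M A phi v w ∧ M.Nonempty)
    ?_ ?_ ?_ ?_ ?_ ?_ h
  · intro phi h
    refine ⟨phi.and (.not (.fall (.mem 0 0))), .fo ⟨h, trivial⟩, fun M A v w => ?_⟩
    simp [SOSat, consVal, Set.Nonempty, ZFSet.mem_irrefl]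
  · rintro n phi - ⟨psi, h1, h2⟩
    exact ⟨psi, .up h1, h2⟩
  · rintro n phi - ⟨psi, h1, h2⟩
    refine ⟨.sall psi, .all h1, fun M A v w => ?_⟩
    simp only [SOSat, h2]
    exact ⟨fun h => ⟨fun P hP => (h P hP).1, (h ∅ (Set.empty_subset _)).2⟩,
      fun h P hP => ⟨h.1 P hP, h.2⟩⟩
  · intro phi h
    refine ⟨phi.and (.not (.fall (.mem 0 0))), .fo ⟨h, trivial⟩, fun M A v w => ?_⟩
    simp [SOSat, consVal, Set.Nonempty, ZFSet.mem_irrefl]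
  · rintro n phi - ⟨psi, h1, h2⟩
    exact ⟨psi, .up h1, h2⟩
  · rintro n phi - ⟨psi, h1, h2⟩
    refine ⟨.not (.sall (.not psi)), .ex h1, fun M A v w => ?_⟩
    simp only [SOSat, h2]
    push Not
    exact ⟨fun ⟨P, hP, h, h'⟩ => ⟨⟨P, hP, h⟩, h'⟩, fun ⟨⟨P, hP, h⟩, h'⟩ => ⟨P, hP, h, h'⟩⟩

/-- `w'` arises from `w` by prepending `k` subsets of `M`. -/
def Extends (M : Set ZFSet.{0}) (k : ℕ) (w w' : ℕ → Set ZFSet.{0}) : Prop :=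
  (∀ i, w' (i + k) = w i) ∧ ∀ i < k, w' i ⊆ M

theorem Extends.zero_iff {M : Set ZFSet.{0}} {w w' : ℕ → Set ZFSet.{0}} :
    Extends M 0 w w' ↔ w' = w := by
  simp [Extends, funext_iff]

theorem Extends.succ_iff {M : Set ZFSet.{0}} {k : ℕ} {w w' : ℕ → Set ZFSet.{0}} :
    Extends M (k + 1) w w' ↔ ∃ P ⊆ M, Extends M k (consVal P w) w' := by
  constructor
  · rintro ⟨h1, h2⟩
    refine ⟨w' k, h2 k (by omega), fun i => ?_, fun i hi => h2 i (by omega)⟩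
    cases i with
    | zero => simp [consVal]
    | succ i => simp [consVal, ← h1 i, add_assoc, add_comm 1 k]
  · rintro ⟨P, hP, h1, h2⟩
    refine ⟨fun i => ?_, fun i hi => ?_⟩
    · rw [show i + (k + 1) = i + 1 + k by omega, h1]
      rfl
    · rcases Nat.lt_succ_iff_lt_or_eq.1 hi with hi | rfl
      · exact h2 i hi
      · have := h1 0
        rw [zero_add] at this
        rw [this]
        exact hP

theorem Extends.subset {M : Set ZFSet.{0}} {k : ℕ} {w w' : ℕ → Set ZFSet.{0}}
    (h : Extends M k w w') (hw : ∀ i, w i ⊆ M) (i : ℕ) : w' i ⊆ M := by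
  by_cases hi : i < k
  · exact h.2 i hi
  · have := h.1 (i - k)
    rw [Nat.sub_add_cancel (by omega)] at this
    exact this ▸ hw _

theorem Extends.inter {M N : Set ZFSet.{0}} {k : ℕ} {w w' : ℕ → Set ZFSet.{0}}
    (h : Extends M k w w') : Extends N k (fun i => w i ∩ N) (fun i => w' i ∩ N) :=
  ⟨fun i => by simp only [h.1], fun _ _ => Set.inter_subset_right⟩

/-- A `Π¹ₙ₊₁` formula is a block of universal quantifiers in front of a `Σ¹ₙ` formula. -/
theorem IsPiForm.exists_block {n : ℕ} : ∀ {phi : SOForm}, IsPiForm (n + 1) phi →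
    ∃ psi k, IsSigmaForm n psi ∧ ∀ M A v w,
      SOSat M A phi v w ↔ ∀ w', Extends M k w w' → SOSat M A psi v w'
  | _, .up h => ⟨_, 0, h, by simp [Extends.zero_iff]⟩
  | _, .all h => by
    obtain ⟨psi, k, h1, h2⟩ := h.exists_block
    refine ⟨psi, k + 1, h1, fun M A v w => ?_⟩
    simp only [SOSat, h2, Extends.succ_iff]
    grind

/-- A `Σ¹ₙ₊₁` formula is a block of existential quantifiers in front of a `Π¹ₙ` formula. -/
theorem IsSigmaForm.exists_block {n : ℕ} : ∀ {phi : SOForm}, IsSigmaForm (n + 1) phi →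
    ∃ psi k, IsPiForm n psi ∧ ∀ M A v w,
      SOSat M A phi v w ↔ ∃ w', Extends M k w w' ∧ SOSat M A psi v w'
  | _, .up h => ⟨_, 0, h, by simp [Extends.zero_iff]⟩
  | _, .ex h => by
    obtain ⟨psi, k, h1, h2⟩ := h.exists_block
    refine ⟨psi, k + 1, h1, fun M A v w => ?_⟩
    simp only [SOSat, h2, Extends.succ_iff]
    grind

/-! ### Coding several predicates into one -/

/-- The double singleton of `x` together with the empty set: the base of the codes. -/
noncomputable def codeBase (x : ZFSet.{0}) : ZFSet.{0} := {{x}, ∅}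

/-- The code of `x` as an element of the `i`-th predicate. -/
noncomputable def code (i : ℕ) (x : ZFSet.{0}) : ZFSet.{0} :=
  (fun y : ZFSet.{0} => ({y} : ZFSet.{0}))^[i] (codeBase x)

theorem code_succ (i : ℕ) (x : ZFSet.{0}) : code (i + 1) x = {code i x} :=
  Function.iterate_succ_apply' _ _ _

theorem zfset_singleton_ne_empty (x : ZFSet.{0}) : ({x} : ZFSet.{0}) ≠ ∅ := fun h =>
  ZFSet.notMem_empty x (h ▸ ZFSet.mem_singleton.2 rfl)

theorem codeBase_injective : Function.Injective codeBase := by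
  intro x y h
  have : ({x} : ZFSet.{0}) ∈ codeBase y := h ▸ by simp [codeBase]
  simpa [codeBase, zfset_singleton_ne_empty, ZFSet.singleton_injective.eq_iff] using this

theorem codeBase_ne_singleton (x y : ZFSet.{0}) : codeBase x ≠ {y} := by
  intro h
  have h1 : ({x} : ZFSet.{0}) ∈ ({y} : ZFSet.{0}) := h ▸ by simp [codeBase]
  have h2 : (∅ : ZFSet.{0}) ∈ ({y} : ZFSet.{0}) := h ▸ by simp [codeBase]
  rw [ZFSet.mem_singleton] at h1 h2
  exact zfset_singleton_ne_empty x (h1.trans h2.symm)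

theorem code_inj {i j : ℕ} {x y : ZFSet.{0}} : code i x = code j y ↔ i = j ∧ x = y := by
  refine ⟨fun h => ?_, fun ⟨h1, h2⟩ => h1 ▸ h2 ▸ rfl⟩
  induction i generalizing j with
  | zero =>
    cases j with
    | zero => exact ⟨rfl, codeBase_injective h⟩
    | succ j => rw [code_succ] at h; exact absurd h (codeBase_ne_singleton _ _)
  | succ i ih =>
    cases j with
    | zero => rw [code_succ] at h; exact absurd h.symm (codeBase_ne_singleton _ _)
    | succ j =>
      rw [code_succ, code_succ] at h
      obtain ⟨rfl, rfl⟩ := ih (ZFSet.singleton_injective h)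
      exact ⟨rfl, rfl⟩

theorem singleton_mem_Vrank {xi : Ordinal.{0}} (hxi : IsSuccPrelimit xi) {x : ZFSet.{0}}
    (hx : x ∈ Vrank xi) : {x} ∈ Vrank xi := by
  simpa [Vrank, ZFSet.rank_singleton] using hxi.succ_lt hx

theorem codeBase_mem_Vrank {xi : Ordinal.{0}} (hxi : IsSuccPrelimit xi) {x : ZFSet.{0}}
    (hx : x ∈ Vrank xi) : codeBase x ∈ Vrank xi := by
  have h1 := singleton_mem_Vrank hxi hx
  have h0 : (∅ : ZFSet.{0}) ∈ Vrank xi := by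
    simpa [Vrank] using zero_le.trans_lt hx
  have := hxi.succ_lt (show ZFSet.rank {x} < xi from h1)
  have := hxi.succ_lt (show ZFSet.rank ∅ < xi from h0)
  simp_all [Vrank, codeBase]

theorem code_mem_Vrank {xi : Ordinal.{0}} (hxi : IsSuccPrelimit xi) {x : ZFSet.{0}}
    (hx : x ∈ Vrank xi) (i : ℕ) : code i x ∈ Vrank xi := by
  induction i with
  | zero => exact codeBase_mem_Vrank hxi hx
  | succ i ih => rw [code_succ]; exact singleton_mem_Vrank hxi ih

/-- Biconditional. -/
def SOForm.iff (p q : SOForm) : SOForm := (SOForm.not (p.and q.not)).and (SOForm.not (q.and p.not))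

/-- Disjunction. -/
def SOForm.or (p q : SOForm) : SOForm := SOForm.not (p.not.and q.not)

/-- First-order existential quantifier. -/
def SOForm.fex (p : SOForm) : SOForm := SOForm.not (.fall p.not)

/-- Equality of first-order variables. -/
def eqForm (a b : ℕ) : SOForm := .fall (.iff (.mem 0 (a + 1)) (.mem 0 (b + 1)))

/-- The formula `a = {b}`. -/
def singForm (a b : ℕ) : SOForm := .fall (.iff (.mem 0 (a + 1)) (eqForm 0 (b + 1)))

/-- The formula `a = codeBase b`. -/
def baseForm (a b : ℕ) : SOForm :=
  .fall (.iff (.mem 0 (a + 1)) (.or (singForm 0 (b + 1)) (.fall (.not (.mem 0 1)))))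

/-- The formula stating that the `i`-fold singleton of `j` lies in `A`. -/
def iterForm : ℕ → ℕ → SOForm
  | 0, j => .inA j
  | i + 1, j => .fex (.and (singForm 0 (j + 1)) (iterForm i 0))

/-- The formula stating that `code i j` lies in `A`. -/
def codeForm (i j : ℕ) : SOForm := .fex (.and (baseForm 0 (j + 1)) (iterForm i 0))

section Sat

variable {M A : Set ZFSet.{0}} {v : ℕ → ZFSet.{0}} {w : ℕ → Set ZFSet.{0}}

theorem sat_iff {p q : SOForm} :
    SOSat M A (.iff p q) v w ↔ (SOSat M A p v w ↔ SOSat M A q v w) := by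
  simp only [SOForm.iff, SOSat]; tauto

theorem sat_or {p q : SOForm} :
    SOSat M A (.or p q) v w ↔ (SOSat M A p v w ∨ SOSat M A q v w) := by
  simp only [SOForm.or, SOSat]; tauto

theorem sat_fex {p : SOForm} :
    SOSat M A (.fex p) v w ↔ ∃ x ∈ M, SOSat M A p (consVal x v) w := by
  simp [SOForm.fex, SOSat]

theorem consVal_mem {x : ZFSet.{0}} (hx : x ∈ M) (hv : ∀ i, v i ∈ M) (i : ℕ) :
    consVal x v i ∈ M := by
  cases i
  · exact hx
  · exact hv _

theorem ext_of_transitive (hM : ∀ x ∈ M, ∀ y ∈ x, y ∈ M) {a b : ZFSet.{0}} (ha : a ∈ M)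
    (hb : b ∈ M) : (∀ x ∈ M, x ∈ a ↔ x ∈ b) ↔ a = b := by
  refine ⟨fun h => ZFSet.ext fun z => ⟨fun hz => ?_, fun hz => ?_⟩, by rintro rfl; simp⟩
  · exact (h z (hM a ha z hz)).1 hz
  · exact (h z (hM b hb z hz)).2 hz

theorem sat_eqForm (hM : ∀ x ∈ M, ∀ y ∈ x, y ∈ M) (hv : ∀ i, v i ∈ M) {a b : ℕ} :
    SOSat M A (eqForm a b) v w ↔ v a = v b := by
  simp only [eqForm, SOSat, sat_iff, consVal]
  exact ext_of_transitive hM (hv a) (hv b)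

variable {xi : Ordinal.{0}}

theorem Vrank_transitive (xi : Ordinal.{0}) : ∀ x ∈ Vrank xi, ∀ y ∈ x, y ∈ Vrank xi :=
  fun _ hx _ hy => (ZFSet.rank_lt_of_mem hy).trans hx

theorem sat_singForm (hxi : IsSuccPrelimit xi) (hv : ∀ i, v i ∈ Vrank xi) {a b : ℕ} :
    SOSat (Vrank xi) A (singForm a b) v w ↔ v a = {v b} := by
  rw [← ext_of_transitive (Vrank_transitive xi) (hv a) (singleton_mem_Vrank hxi (hv b))]
  simp only [singForm, SOSat, sat_iff]
  refine forall₂_congr fun x hx => ?_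
  rw [sat_eqForm (Vrank_transitive xi) (consVal_mem hx hv)]
  simp [consVal]

theorem sat_baseForm (hxi : IsSuccPrelimit xi) (hv : ∀ i, v i ∈ Vrank xi) {a b : ℕ} :
    SOSat (Vrank xi) A (baseForm a b) v w ↔ v a = codeBase (v b) := by
  rw [← ext_of_transitive (Vrank_transitive xi) (hv a) (codeBase_mem_Vrank hxi (hv b))]
  simp only [baseForm, SOSat, sat_iff, sat_or]
  refine forall₂_congr fun x hx => ?_
  rw [sat_singForm hxi (consVal_mem hx hv)]
  have : (∀ y ∈ Vrank xi, y ∉ x) ↔ x = ∅ := by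
    rw [ZFSet.eq_empty]
    exact ⟨fun h y hy => h y (Vrank_transitive xi x hx y hy) hy, fun h y _ => h y⟩
  simp [consVal, codeBase, this]

theorem sat_iterForm (hxi : IsSuccPrelimit xi) {i j : ℕ} (hv : ∀ i, v i ∈ Vrank xi) :
    SOSat (Vrank xi) A (iterForm i j) v w ↔
      (fun y : ZFSet.{0} => ({y} : ZFSet.{0}))^[i] (v j) ∈ A := by
  induction i generalizing j v with
  | zero => rfl
  | succ i ih =>
    simp only [iterForm, sat_fex, SOSat]
    rw [Function.iterate_succ_apply]
    constructor
    · rintro ⟨x, hx, h1, h2⟩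
      rw [sat_singForm hxi (consVal_mem hx hv)] at h1
      rw [ih (consVal_mem hx hv)] at h2
      change x = {v j} at h1
      rw [← h1]
      exact h2
    · intro h
      have hx := singleton_mem_Vrank hxi (hv j)
      refine ⟨_, hx, ?_, ?_⟩
      · rw [sat_singForm hxi (consVal_mem hx hv)]
        rfl
      · rw [ih (consVal_mem hx hv)]
        exact h

theorem sat_codeForm (hxi : IsSuccPrelimit xi) {i j : ℕ} (hv : ∀ i, v i ∈ Vrank xi) :
    SOSat (Vrank xi) A (codeForm i j) v w ↔ code i (v j) ∈ A := by
  simp only [codeForm, sat_fex, SOSat]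
  constructor
  · rintro ⟨x, hx, h1, h2⟩
    rw [sat_baseForm hxi (consVal_mem hx hv)] at h1
    rw [sat_iterForm hxi (consVal_mem hx hv)] at h2
    change x = codeBase (v j) at h1
    rw [code, ← h1]
    exact h2
  · intro h
    have hx := codeBase_mem_Vrank hxi (hv j)
    refine ⟨_, hx, ?_, ?_⟩
    · rw [sat_baseForm hxi (consVal_mem hx hv)]
      rfl
    · rw [sat_iterForm hxi (consVal_mem hx hv)]
      exact h

end Sat

/-- Replace `A` and the second-order variables that are free under `d` second-order quantifiers
by the predicates coded in a single one. -/
def SOForm.decode : ℕ → SOForm → SOForm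
  | _, .mem i j => .mem i j
  | d, .app i j => if i < d then .app i j else codeForm (i - d + 1) j
  | _, .inA i => codeForm 0 i
  | d, .not phi => .not (phi.decode d)
  | d, .and phi psi => .and (phi.decode d) (psi.decode d)
  | d, .fall phi => .fall (phi.decode d)
  | d, .sall phi => .sall (phi.decode (d + 1))

theorem iterForm_fo (i j : ℕ) : (iterForm i j).FO := by
  induction i generalizing j with
  | zero => trivial
  | succ i ih => simp [iterForm, SOForm.fex, SOForm.FO, ih, singForm, eqForm, SOForm.iff]

theorem codeForm_fo (i j : ℕ) : (codeForm i j).FO := by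
  simp [codeForm, SOForm.fex, SOForm.FO, iterForm_fo, baseForm, singForm, eqForm, SOForm.iff,
    SOForm.or]

theorem SOForm.FO.decode {phi : SOForm} (h : phi.FO) (d : ℕ) : (phi.decode d).FO := by
  induction phi with
  | mem i j => trivial
  | app i j =>
    simp only [SOForm.decode]
    split_ifs
    · trivial
    · exact codeForm_fo _ _
  | inA i => exact codeForm_fo _ _
  | not phi ih => exact ih h
  | and phi psi ih1 ih2 => exact ⟨ih1 h.1, ih2 h.2⟩
  | fall phi ih => exact ih h
  | sall phi => exact h.elim

theorem IsPiForm.decode {n : ℕ} {phi : SOForm} (h : IsPiForm n phi) (d : ℕ) :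
    IsPiForm n (phi.decode d) := by
  refine IsPiForm.rec
    (motive_1 := fun n phi _ => ∀ d, IsPiForm n (phi.decode d))
    (motive_2 := fun n phi _ => ∀ d, IsSigmaForm n (phi.decode d))
    (fun h d => .fo (h.decode d)) (fun _ ih d => .up (ih d)) (fun _ ih d => .all (ih _))
    (fun h d => .fo (h.decode d)) (fun _ ih d => .up (ih d)) (fun _ ih d => .ex (ih _)) h d

theorem sat_decode {xi : Ordinal.{0}} (hxi : IsSuccPrelimit xi) {A A' : Set ZFSet.{0}}
    (hA : ∀ x ∈ Vrank xi, code 0 x ∈ A' ↔ x ∈ A) (phi : SOForm) (d : ℕ) (v : ℕ → ZFSet.{0})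
    (w w' : ℕ → Set ZFSet.{0}) (hv : ∀ i, v i ∈ Vrank xi) (hd : ∀ i < d, w' i = w i)
    (hw : ∀ i, ∀ x ∈ Vrank xi, code (i + 1) x ∈ A' ↔ x ∈ w (i + d)) :
    SOSat (Vrank xi) A' (phi.decode d) v w' ↔ SOSat (Vrank xi) A phi v w := by
  induction phi generalizing d v w w' with
  | mem i j => rfl
  | app i j =>
    simp only [SOForm.decode]
    split_ifs with h
    · simp only [SOSat, hd i h]
    · rw [sat_codeForm hxi hv, hw _ _ (hv j), Nat.sub_add_cancel (by omega)]
      rfl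
  | inA i => exact (sat_codeForm hxi hv).trans (hA _ (hv i))
  | not phi ih => exact not_congr (ih d v w w' hv hd hw)
  | and phi psi ih1 ih2 => exact and_congr (ih1 d v w w' hv hd hw) (ih2 d v w w' hv hd hw)
  | fall phi ih => exact forall₂_congr fun x hx => ih d _ w w' (consVal_mem hx hv) hd hw
  | sall phi ih =>
    refine forall₂_congr fun P _ => ih (d + 1) v _ _ hv (fun i hi => ?_) hw
    cases i with
    | zero => rfl
    | succ i => exact hd i (by omega)

/-- Indescribability with respect to formulas with set parameters. -/
theorem PiIndesc.exists_sat {n : ℕ} {H : Set Ordinal.{0}} {kappa : Ordinal.{0}}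
    (h : PiIndesc n H kappa) (hk : IsSuccLimit kappa)
    (hH : ∀ xi ∈ H, xi ≠ 0 → IsSuccLimit xi) {A : Set ZFSet.{0}} (hA : A ⊆ Vrank kappa)
    {w : ℕ → Set ZFSet.{0}} (hw : ∀ i, w i ⊆ Vrank kappa) {phi : SOForm} (hphi : IsPiForm n phi)
    (hsat : SOSat (Vrank kappa) A phi (fun _ => ∅) w) :
    ∃ xi ∈ H, xi ≠ 0 ∧
      SOSat (Vrank xi) (A ∩ Vrank xi) phi (fun _ => ∅) (fun i => w i ∩ Vrank xi) := by
  obtain ⟨psi, hpsi, hpsi'⟩ := (hphi.decode 0).exists_and_nonempty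
  let A' : Set ZFSet.{0} := {z | (∃ a ∈ A, code 0 a = z) ∨ ∃ i, ∃ x ∈ w i, code (i + 1) x = z}
  have hA' : A' ⊆ Vrank kappa := by
    rintro z (⟨a, ha, rfl⟩ | ⟨i, a, ha, rfl⟩)
    · exact code_mem_Vrank hk.isSuccPrelimit (hA ha) _
    · exact code_mem_Vrank hk.isSuccPrelimit (hw i ha) _
  have h0 (x) : code 0 x ∈ A' ↔ x ∈ A := by simp [A', code_inj]
  have h1 (i x) : code (i + 1) x ∈ A' ↔ x ∈ w i := by simp [A', code_inj]
  have hempty {xi : Ordinal.{0}} (hxi : xi ≠ 0) : (∅ : ZFSet.{0}) ∈ Vrank xi := by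
    simpa [Vrank] using pos_iff_ne_zero.2 hxi
  obtain ⟨xi, hxi, hs⟩ := h.2 A' hA' psi hpsi <| by
    refine (hpsi' _ _ _ _).2 ⟨?_, ∅, hempty hk.ne_bot⟩
    exact (sat_decode hk.isSuccPrelimit (fun x _ => h0 x) phi 0 _ w _ (fun _ => hempty hk.ne_bot)
      (by simp) (fun i x _ => h1 i x)).2 hsat
  obtain ⟨hs, y, hy⟩ := (hpsi' _ _ _ _).1 hs
  have hxi0 : xi ≠ 0 := by
    rintro rfl
    exact not_lt_zero (show ZFSet.rank _ < 0 from hy)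
  have hlim := (hH xi hxi hxi0).isSuccPrelimit
  refine ⟨xi, hxi, hxi0, (sat_decode hlim (fun x hx => ?_) phi 0 _ _ _ (fun _ => hempty hxi0)
    (by simp) (fun i x hx => ?_)).1 hs⟩
  · simp [h0, hx, code_mem_Vrank hlim hx]
  · simp [h1, hx, code_mem_Vrank hlim hx]

/-! ### Positive sets and inaccessibility -/

/-- Every `S`-list has a `Π¹ₙ`-indescribable homogeneous set. -/
def HasPosHomog (n : ℤ) (S : Set Ordinal.{0}) (kappa : Ordinal.{0}) : Prop :=
  ∀ L : Ordinal.{0} → Set Ordinal.{0}, (∀ alpha ∈ S, L alpha ⊆ Set.Iio alpha) →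
    ∃ H, H ⊆ S ∧ PiPos n H kappa ∧ Homog L H

theorem PiPos.subset {n : ℤ} {H : Set Ordinal.{0}} {kappa : Ordinal.{0}}
    (h : PiPos n H kappa) : H ⊆ Set.Iio kappa := by
  cases n <;> exact h.1

/-- A `Π¹ₙ`-indescribable subset of an infinite cardinal is unbounded. -/
theorem PiPos.exists_gt {n : ℤ} {H : Set Ordinal.{0}} {c : Cardinal.{0}} (hc : ℵ₀ ≤ c)
    (h : PiPos n H c.ord) {gamma : Ordinal.{0}} (hg : gamma < c.ord) :
    ∃ alpha ∈ H, gamma < alpha := by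
  cases n with
  | ofNat m =>
    have hfo : (SOForm.not (.fall (.not (.inA 0)))).FO := trivial
    obtain ⟨xi, hxi, hs⟩ := h.2 {gamma.toZFSet} (by simpa [Vrank] using hg) _
      (IsPiForm.of_fo hfo m).1 (by simpa [SOSatS, SOSat, consVal, Vrank] using hg)
    refine ⟨xi, hxi, ?_⟩
    simpa [SOSatS, SOSat, consVal, Vrank] using hs
  | negSucc m =>
    by_contra! hb
    have hsub : H ⊆ Set.Iio (succ gamma) := fun x hx => lt_succ_of_le (hb x hx)
    have h1 := Cardinal.mk_le_mk_of_subset hsub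
    have h2 : succ gamma < c.ord := (isSuccLimit_ord hc).succ_lt hg
    rw [h.2, Cardinal.mk_Iio_ordinal, Cardinal.card_ord, Cardinal.lift_le] at h1
    exact absurd (Cardinal.lt_ord.1 h2) h1.not_gt

theorem HasPosHomog.isInaccessible {n : ℤ} {S : Set Ordinal.{0}} {c : Cardinal.{0}}
    (h : HasPosHomog n S c.ord) (hc : ℵ₀ < c) (hreg : c ≤ c.ord.cof) : c.IsInaccessible := by
  refine ⟨hc, hreg, fun x hx => ?_⟩
  by_contra! hle
  have hcard : #(Set.Iio c.ord) ≤ #(Set (Set.Iio x.ord)) := by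
    rw [Cardinal.mk_set, Cardinal.mk_Iio_ordinal, Cardinal.mk_Iio_ordinal, Cardinal.card_ord,
      Cardinal.card_ord, ← Cardinal.lift_two_power, Cardinal.lift_le]
    exact hle
  obtain ⟨g⟩ := hcard
  obtain ⟨H, -, hpos, hH⟩ := h (fun alpha => {y | y < alpha ∧ ∃ (h : alpha < c.ord) (hy : y < x.ord),
    (⟨y, hy⟩ : Set.Iio x.ord) ∈ g ⟨alpha, h⟩}) (fun alpha _ y hy => hy.1)
  obtain ⟨alpha, ha, hxa⟩ := hpos.exists_gt hc.le (Cardinal.ord_lt_ord.2 hx)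
  have hac : alpha < c.ord := hpos.subset ha
  obtain ⟨beta, hb, hab⟩ := hpos.exists_gt hc.le hac
  have hbc : beta < c.ord := hpos.subset hb
  have key := hH alpha ha beta hb hab
  have : g ⟨alpha, hac⟩ = g ⟨beta, hbc⟩ := by
    ext ⟨y, hy⟩
    have hy' : y < x.ord := hy
    have hya := hy'.trans hxa
    have := Set.ext_iff.1 key y
    simpa [hya, hy', hya.trans hab, hac, hbc] using this
  exact hab.ne (congrArg Subtype.val (g.injective this))

theorem mk_Vrank (alpha : Ordinal.{0}) : #(Vrank alpha) = lift.{1} (preBeth alpha) := by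
  rw [← ZFSet.card_vonNeumann, ← ZFSet.cardinalMk_coe_sort]
  have : Vrank alpha = {x | x ∈ ZFSet.vonNeumann alpha} := by
    ext x
    simp [Vrank, ZFSet.mem_vonNeumann]
  rw [this]
  rfl

/-! ### Homogeneous sets of closure points -/

/-- The homogeneous sets may be taken to consist of closure points of a given function. -/
theorem HasPosHomog.exists_closed {n : ℤ} {S : Set Ordinal.{0}} {c : Cardinal.{0}}
    (h : HasPosHomog n S c.ord) (hc : ℵ₀ ≤ c) {g : Ordinal.{0} → Ordinal.{0}}
    (hg : ∀ d < c.ord, g d < c.ord) (hg0 : Ordinal.omega0 ≤ g 0)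
    {L : Ordinal.{0} → Set Ordinal.{0}} (hL : ∀ alpha ∈ S, L alpha ⊆ Set.Iio alpha) :
    ∃ H ⊆ S, PiPos n H c.ord ∧ (∀ alpha ∈ H, alpha ≠ 0 → ∀ d < alpha, g d < alpha) ∧
      ∀ alpha ∈ H, alpha ≠ 0 → ∀ beta ∈ H, alpha < beta → L alpha = L beta ∩ Set.Iio alpha := by
  classical
  let wit (alpha : Ordinal.{0}) : Set Ordinal.{0} := {d | d < alpha ∧ alpha ≤ g d}
  let tr (alpha : Ordinal.{0}) : Set Ordinal.{0} := {1, 2} ∪ (fun x => 3 + x) '' L alpha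
  let L' (alpha : Ordinal.{0}) : Set Ordinal.{0} :=
    if (wit alpha).Nonempty then {sInf (wit alpha)} else tr alpha ∩ Set.Iio alpha
  have hwit {alpha} (ha : (wit alpha).Nonempty) : sInf (wit alpha) ∈ wit alpha := csInf_mem ha
  have hbad {alpha} (ha : (wit alpha).Nonempty) : L' alpha = {sInf (wit alpha)} := if_pos ha
  have hgood {alpha} (ha : ¬ (wit alpha).Nonempty) : L' alpha = tr alpha ∩ Set.Iio alpha :=
    if_neg ha
  have hclosed {alpha} (ha : ¬ (wit alpha).Nonempty) : ∀ d < alpha, g d < alpha :=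
    fun d hd => not_le.1 fun h => ha ⟨d, hd, h⟩
  have h12 {alpha} (ha : Ordinal.omega0 < alpha) :
      1 ∈ tr alpha ∩ Set.Iio alpha ∧ 2 ∈ tr alpha ∩ Set.Iio alpha :=
    ⟨⟨.inl (.inl rfl), (Ordinal.one_lt_omega0).trans ha⟩,
      ⟨.inl (.inr rfl), (Ordinal.natCast_lt_omega0 2).trans ha⟩⟩
  have hadd {alpha} (ha : Ordinal.omega0 < alpha) (x : Ordinal.{0}) :
      3 + x < alpha ↔ x < alpha := by
    have h3 : (3 : Ordinal.{0}) + alpha = alpha :=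
      Ordinal.natCast_add_of_omega0_le ha.le 3
    conv_lhs => rw [← h3]
    exact add_lt_add_iff_left 3
  have htr {alpha} (x : Ordinal.{0}) : 3 + x ∈ tr alpha ↔ x ∈ L alpha := by
    have h3 : (3 : Ordinal.{0}) ≤ 3 + x := le_self_add
    have h1 : 3 + x ≠ 1 := by
      rintro h
      rw [h] at h3
      exact absurd h3 (by norm_num)
    have h2 : 3 + x ≠ 2 := by
      rintro h
      rw [h] at h3
      exact absurd h3 (by norm_num)
    simp [tr, h1, h2]
  have hpos0 {alpha} (h0 : alpha ≠ 0) (ha : ¬ (wit alpha).Nonempty) : Ordinal.omega0 < alpha :=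
    hg0.trans_lt (hclosed ha 0 (pos_iff_ne_zero.2 h0))
  obtain ⟨H, hHS, hpos, hH⟩ := h L' fun alpha _ => by
    by_cases ha : (wit alpha).Nonempty
    · rw [hbad ha, Set.singleton_subset_iff]
      exact (hwit ha).1
    · rw [hgood ha]
      exact Set.inter_subset_right
  have hiff {alpha beta} (ha : alpha ∈ H) (h0 : alpha ≠ 0) (hb : beta ∈ H) (hab : alpha < beta) :
      (wit alpha).Nonempty ↔ (wit beta).Nonempty := by
    have key := hH alpha ha beta hb hab
    by_cases h1 : (wit alpha).Nonempty <;> by_cases h2 : (wit beta).Nonempty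
    · simp [h1, h2]
    · exfalso
      rw [hbad h1, hgood h2] at key
      have hd : sInf (wit alpha) ∈ tr beta ∩ Set.Iio beta ∩ Set.Iio alpha := key ▸ rfl
      have hne : sInf (wit alpha) ≠ 0 := by
        intro h
        rw [h] at hd
        simp [tr] at hd
      have hw : g 0 < alpha := by
        by_contra! hle
        exact hne (le_zero_iff.1 (csInf_le' ⟨pos_iff_ne_zero.2 h0, hle⟩))
      have hom := hg0.trans_lt hw
      have e1 : (1 : Ordinal.{0}) ∈ ({sInf (wit alpha)} : Set _) :=
        key ▸ ⟨(h12 (hom.trans hab)).1, (h12 hom).1.2⟩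
      have e2 : (2 : Ordinal.{0}) ∈ ({sInf (wit alpha)} : Set _) :=
        key ▸ ⟨(h12 (hom.trans hab)).2, (h12 hom).2.2⟩
      exact absurd (e1.trans e2.symm) (by norm_num)
    · exfalso
      rw [hgood h1, hbad h2] at key
      obtain ⟨e1, e2⟩ := h12 (hpos0 h0 h1)
      rw [key] at e1 e2
      exact absurd (e1.1.trans e2.1.symm) (by norm_num)
    · simp [h1, h2]
  have hall : ∀ alpha ∈ H, alpha ≠ 0 → ¬ (wit alpha).Nonempty := by
    intro alpha ha h0 hw
    have hd : sInf (wit alpha) < c.ord := (hwit hw).1.trans (hpos.subset ha)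
    obtain ⟨beta, hb, hlt⟩ := hpos.exists_gt hc (max_lt (hpos.subset ha) (hg _ hd))
    obtain ⟨hab, hgb⟩ := max_lt_iff.1 hlt
    have hwb := (hiff ha h0 hb hab).1 hw
    have key := hH alpha ha beta hb hab
    rw [hbad hw, hbad hwb] at key
    have : sInf (wit alpha) ∈ ({sInf (wit beta)} : Set _) ∩ Set.Iio alpha := key ▸ rfl
    have heq : sInf (wit alpha) = sInf (wit beta) := this.1
    exact (heq ▸ hgb).not_ge (hwit hwb).2
  refine ⟨H, hHS, hpos, fun alpha ha h0 => hclosed (hall alpha ha h0),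
    fun alpha ha h0 beta hb hab => ?_⟩
  have key := hH alpha ha beta hb hab
  have hom := hpos0 h0 (hall alpha ha h0)
  rw [hgood (hall alpha ha h0), hgood (hall beta hb (h0.bot_lt.trans hab).ne')] at key
  ext x
  have hx := Set.ext_iff.1 key (3 + x)
  simp only [Set.mem_inter_iff, htr, Set.mem_Iio, hadd hom, hadd (hom.trans hab)] at hx ⊢
  have := @hL alpha (hHS ha) x
  have hxb : x < alpha → x < beta := fun h => h.trans hab
  simp only [Set.mem_Iio] at this
  tauto

/-! ### Coherent choices of predicates -/

/-- A Gödel numbering of the second-order formulas. -/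
def SOForm.goedel : SOForm → ℕ
  | .mem i j => Nat.pair 0 (Nat.pair i j)
  | .app i j => Nat.pair 1 (Nat.pair i j)
  | .inA i => Nat.pair 2 i
  | .not p => Nat.pair 3 p.goedel
  | .and p q => Nat.pair 4 (Nat.pair p.goedel q.goedel)
  | .fall p => Nat.pair 5 p.goedel
  | .sall p => Nat.pair 6 p.goedel

theorem SOForm.goedel_injective : Function.Injective SOForm.goedel := by
  intro p
  induction p <;> intro q h <;> cases q <;> simp_all [SOForm.goedel, Nat.pair_eq_pair] <;> grind

instance : Countable SOForm := SOForm.goedel_injective.countable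

/-- A formula together with finitely many parameters from `V_α`. -/
def paramForms (alpha : Ordinal.{0}) : Set (SOForm × List ZFSet.{0}) :=
  {e | ∀ x ∈ e.2, x ∈ Vrank alpha}

theorem Vrank_mono {alpha beta : Ordinal.{0}} (h : alpha ≤ beta) : Vrank alpha ⊆ Vrank beta :=
  fun _ hx => lt_of_lt_of_le hx h

theorem paramForms_mono {alpha beta : Ordinal.{0}} (h : alpha ≤ beta) :
    paramForms alpha ⊆ paramForms beta :=
  fun _ he x hx => Vrank_mono h (he x hx)

theorem mk_paramForms_le (alpha : Ordinal.{0}) :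
    #(paramForms alpha) ≤ max ℵ₀ #(Vrank alpha) := by
  have hsurj : Function.Surjective
      (fun e : SOForm × List (Vrank alpha) =>
        (⟨(e.1, e.2.map Subtype.val), fun x hx => by
          obtain ⟨y, -, rfl⟩ := List.mem_map.1 hx
          exact y.2⟩ : paramForms alpha)) := by
    rintro ⟨⟨p, l⟩, hl⟩
    refine ⟨(p, l.attach.map fun x => ⟨x.1, hl x.1 x.2⟩), ?_⟩
    simp
  refine (Cardinal.mk_le_of_surjective hsurj).trans ?_
  rw [Cardinal.mk_prod]
  refine Cardinal.mul_le_of_le (le_max_left _ _) ?_ ?_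
  · simp
  · simpa using Cardinal.mk_list_le_max (Vrank alpha)

theorem exists_mem_paramForms_succ {alpha : Ordinal.{0}} (h0 : alpha ≠ 0)
    {e : SOForm × List ZFSet.{0}}
    (he : e ∈ paramForms alpha) : ∃ d < alpha, e ∈ paramForms (succ d) := by
  obtain ⟨p, l⟩ := e
  induction l with
  | nil => exact ⟨0, pos_iff_ne_zero.2 h0, by simp [paramForms]⟩
  | cons x l ih =>
    obtain ⟨d, hd, hl⟩ := ih fun y hy => he y (List.mem_cons_of_mem _ hy)
    have hx : ZFSet.rank x < alpha := he x List.mem_cons_self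
    refine ⟨max d (ZFSet.rank x), max_lt hd hx, fun y hy => ?_⟩
    rcases List.mem_cons.1 hy with rfl | hy
    · exact lt_succ_of_le (le_max_right d _)
    · exact Vrank_mono (succ_le_succ (le_max_left _ _)) (hl y hy)

/-- The valuation listing the given parameters. -/
def listVal (l : List ZFSet.{0}) : ℕ → ZFSet.{0} :=
  l.foldr consVal fun _ => ∅

/-- The predicates `w ξ` on the levels `V_ξ`, `0 ≠ ξ ∈ H`, cohere elementarily. -/
def IsCoherent (H : Set Ordinal.{0}) (A : Set ZFSet.{0}) (w : Ordinal.{0} → ℕ → Set ZFSet.{0}) :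
    Prop :=
  ∀ alpha ∈ H, alpha ≠ 0 → ∀ beta ∈ H, alpha < beta → ∀ e ∈ paramForms alpha,
    (SOSat (Vrank alpha) (A ∩ Vrank alpha) e.1 (listVal e.2) (w alpha) ↔
      SOSat (Vrank beta) (A ∩ Vrank beta) e.1 (listVal e.2) (w beta))

/-- Predicates chosen on the levels `V_ξ`, `ξ ∈ S`, cohere elementarily on a positive set. -/
theorem HasPosHomog.exists_coherent {n : ℤ} {S : Set Ordinal.{0}} {c : Cardinal.{0}}
    (h : HasPosHomog n S c.ord) (hc : ℵ₀ < c) (hreg : c.IsRegular) (A : Set ZFSet.{0})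
    (w : Ordinal.{0} → ℕ → Set ZFSet.{0}) :
    ∃ H ⊆ S, PiPos n H c.ord ∧ (∀ alpha ∈ H, alpha ≠ 0 → IsSuccLimit alpha) ∧
      IsCoherent H A w := by
  have hin := h.isInaccessible hc hreg.2
  have hlim := isSuccLimit_ord hc.le
  have hV {d} (hd : d < c.ord) : #(paramForms d) < lift.{1} c := by
    refine (mk_paramForms_le d).trans_lt (max_lt (by simpa using hc) ?_)
    rw [mk_Vrank, Cardinal.lift_lt, ← hin.preBeth_ord]
    exact preBeth_strictMono hd
  have hVc : #(paramForms c.ord) ≤ #(Set.Iio c.ord) := by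
    rw [Cardinal.mk_Iio_ordinal, Cardinal.card_ord]
    refine (mk_paramForms_le _).trans (max_le (by simpa using hc.le) ?_)
    rw [mk_Vrank, hin.preBeth_ord]
  obtain ⟨F⟩ := hVc
  obtain ⟨f, hf⟩ : ∃ f : SOForm × List ZFSet.{0} → Ordinal.{0},
      ∀ e : paramForms c.ord, f e = F e := by
    classical
    exact ⟨fun e => if he : e ∈ paramForms c.ord then F ⟨e, he⟩ else 0, fun e => by simp⟩
  have hinj : Set.InjOn f (paramForms c.ord) := fun e he e' he' h => by
    rw [hf ⟨e, he⟩, hf ⟨e', he'⟩] at h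
    exact congrArg Subtype.val (F.injective (Subtype.ext h))
  have hmaps {e} (he : e ∈ paramForms c.ord) : f e < c.ord := by
    rw [hf ⟨e, he⟩]
    exact (F ⟨e, he⟩).2
  have hex (d : Ordinal.{0}) : ∃ b, d < c.ord → b < c.ord ∧ d < b ∧ Ordinal.omega0 ≤ b ∧
      ∀ e ∈ paramForms (succ d), f e ≤ b := by
    by_cases hd : d < c.ord
    swap
    · exact ⟨0, fun h => absurd h hd⟩
    have hs : succ d < c.ord := hlim.succ_lt hd
    have hsm := hV hs
    have hsup : sSup (f '' paramForms (succ d)) < c.ord := by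
      refine Ordinal.sSup_lt_of_lt_cof ?_ ?_
      · refine Cardinal.mk_image_le.trans_lt ?_
        rw [← Ordinal.lift_cof, hreg.cof_ord]
        exact hsm
      · rintro _ ⟨e, he, rfl⟩
        exact hmaps (paramForms_mono hs.le he)
    refine ⟨max (sSup (f '' paramForms (succ d))) (max (succ d) Ordinal.omega0), fun _ =>
      ⟨max_lt hsup (max_lt hs ?_), (lt_succ d).trans_le (by simp), by simp, fun e he => ?_⟩⟩
    · rw [← Cardinal.ord_aleph0]
      exact Cardinal.ord_lt_ord.2 hc
    · refine le_max_of_le_left (le_csSup ⟨c.ord, ?_⟩ ⟨e, he, rfl⟩)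
      rintro _ ⟨e, he, rfl⟩
      exact (hmaps (paramForms_mono hs.le he)).le
  choose g hg using hex
  let L (xi : Ordinal.{0}) : Set Ordinal.{0} := {o | o < xi ∧ ∃ e ∈ paramForms xi, f e = o ∧
    SOSat (Vrank xi) (A ∩ Vrank xi) e.1 (listVal e.2) (w xi)}
  obtain ⟨H, hHS, hpos, hcl, hH⟩ := h.exists_closed hc.le (g := g) (fun d hd => (hg d hd).1)
    (hg 0 hlim.bot_lt).2.2.1 (L := L) fun xi _ o ho => ho.1
  refine ⟨H, hHS, hpos, fun alpha ha h0 => ?_, fun alpha ha h0 beta hb hab e he => ?_⟩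
  · rw [Order.isSuccLimit_iff]
    refine ⟨by simpa using h0, Order.isSuccPrelimit_of_succ_lt fun d hd => ?_⟩
    exact (succ_le_of_lt (hg d (hd.trans (hpos.subset ha))).2.1).trans_lt (hcl alpha ha h0 d hd)
  · have hac : alpha < c.ord := hpos.subset ha
    have hbc : beta < c.ord := hpos.subset hb
    have hfe : f e < alpha := by
      obtain ⟨d, hd, hed⟩ := exists_mem_paramForms_succ h0 he
      exact ((hg d (hd.trans hac)).2.2.2 e hed).trans_lt (hcl alpha ha h0 d hd)
    have hmem {xi} (hxi : xi < c.ord) (hex : e ∈ paramForms xi) (hfx : f e < xi) :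
        f e ∈ L xi ↔ SOSat (Vrank xi) (A ∩ Vrank xi) e.1 (listVal e.2) (w xi) := by
      refine ⟨fun ⟨_, e', he', heq, hs⟩ => ?_, fun hs => ⟨hfx, e, hex, rfl, hs⟩⟩
      rwa [hinj (paramForms_mono hxi.le he') (paramForms_mono hxi.le hex) heq] at hs
    rw [← hmem hac he hfe, ← hmem hbc (paramForms_mono hab.le he) (hfe.trans hab),
      hH alpha ha h0 beta hb hab]
    exact ⟨fun h => h.1, fun h => ⟨h, hfe⟩⟩

/-- The union of a coherent family of predicates. -/
def limitPred (H : Set Ordinal.{0}) (w : Ordinal.{0} → ℕ → Set ZFSet.{0}) (i : ℕ) :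
    Set ZFSet.{0} :=
  {x | ∃ xi ∈ H, xi ≠ 0 ∧ x ∈ w xi i}

theorem IsCoherent.mem_iff {H : Set Ordinal.{0}} {A : Set ZFSet.{0}}
    {w : Ordinal.{0} → ℕ → Set ZFSet.{0}} (h : IsCoherent H A w) {alpha beta : Ordinal.{0}}
    (ha : alpha ∈ H) (h0 : alpha ≠ 0) (hb : beta ∈ H) (hab : alpha < beta) {x : ZFSet.{0}}
    (hx : x ∈ Vrank alpha) (i : ℕ) : x ∈ w alpha i ↔ x ∈ w beta i := by
  simpa [SOSat, listVal, consVal] using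
    h alpha ha h0 beta hb hab (.app i 0, [x]) (by simpa [paramForms] using hx)

theorem IsCoherent.limitPred_inter {H : Set Ordinal.{0}} {A : Set ZFSet.{0}}
    {w : Ordinal.{0} → ℕ → Set ZFSet.{0}} (h : IsCoherent H A w)
    (hw : ∀ xi ∈ H, ∀ i, w xi i ⊆ Vrank xi) {alpha : Ordinal.{0}} (ha : alpha ∈ H)
    (h0 : alpha ≠ 0) (i : ℕ) : limitPred H w i ∩ Vrank alpha = w alpha i := by
  ext x
  refine ⟨fun ⟨⟨xi, hxi, hxi0, hx⟩, hxa⟩ => ?_, fun hx => ⟨⟨alpha, ha, h0, hx⟩, hw alpha ha i hx⟩⟩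
  rcases lt_trichotomy xi alpha with hlt | rfl | hlt
  · exact (h.mem_iff hxi hxi0 ha hlt (hw xi hxi i hx) i).1 hx
  · exact hx
  · exact (h.mem_iff ha h0 hxi hlt hxa i).2 hx

theorem listVal_mem_Vrank {xi : Ordinal.{0}} (h0 : xi ≠ 0) {l : List ZFSet.{0}}
    (hl : ∀ x ∈ l, x ∈ Vrank xi) (i : ℕ) : listVal l i ∈ Vrank xi := by
  induction l generalizing i with
  | nil => simpa [listVal, Vrank] using pos_iff_ne_zero.2 h0
  | cons x l ih =>
    exact consVal_mem (hl x List.mem_cons_self)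
      (ih fun y hy => hl y (List.mem_cons_of_mem _ hy)) i

/-- First-order formulas pass from the levels to the limit: the elementary chain lemma. -/
theorem IsCoherent.sat_limit {H : Set Ordinal.{0}} {A : Set ZFSet.{0}}
    {w : Ordinal.{0} → ℕ → Set ZFSet.{0}} (h : IsCoherent H A w)
    (hw : ∀ xi ∈ H, ∀ i, w xi i ⊆ Vrank xi) {kappa : Ordinal.{0}} (hHk : H ⊆ Set.Iio kappa)
    (hub : ∀ gamma < kappa, ∃ alpha ∈ H, gamma < alpha)
    {phi : SOForm} (hphi : phi.FO) {xi : Ordinal.{0}} (hxi : xi ∈ H)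
    (h0 : xi ≠ 0) {l : List ZFSet.{0}} (hl : ∀ x ∈ l, x ∈ Vrank xi) :
    SOSat (Vrank xi) (A ∩ Vrank xi) phi (listVal l) (w xi) ↔
      SOSat (Vrank kappa) A phi (listVal l) (limitPred H w) := by
  induction phi generalizing xi l with
  | mem i j => rfl
  | app i j =>
    simp [SOSat, ← h.limitPred_inter hw hxi h0 i, listVal_mem_Vrank h0 hl]
  | inA i => simp [SOSat, listVal_mem_Vrank h0 hl]
  | not p ih => exact not_congr (ih hphi hxi h0 hl)
  | and p q ihp ihq => exact and_congr (ihp hphi.1 hxi h0 hl) (ihq hphi.2 hxi h0 hl)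
  | fall p ih =>
    refine ⟨fun hs x hx => ?_, fun hs x hx => ?_⟩
    · obtain ⟨eta, heta, hlt⟩ := hub _ (max_lt (hHk hxi) hx)
      obtain ⟨h1, h2⟩ := max_lt_iff.1 hlt
      have hs' := (h xi hxi h0 eta heta h1 (.fall p, l) hl).1 hs
      refine (ih hphi heta h1.ne_bot (l := x :: l) fun y hy => ?_).1 (hs' x h2)
      rcases List.mem_cons.1 hy with rfl | hy
      · exact h2
      · exact Vrank_mono h1.le (hl y hy)
    · refine (ih hphi hxi h0 (l := x :: l) fun y hy => ?_).2
        (hs x (Vrank_mono (le_of_lt (hHk hxi)) hx))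
      rcases List.mem_cons.1 hy with rfl | hy
      · exact hx
      · exact hl y hy
  | sall p ih => exact hphi.elim

/-! ### Indescribability -/

/-- If `Σ¹ₘ` formulas reflect from limits of coherent families to their members, then a set all
of whose lists have positive homogeneous sets is `Π¹ₘ₊₁`-indescribable. -/
theorem HasPosHomog.piIndesc {n : ℤ} {m : ℕ} {S : Set Ordinal.{0}} {c : Cardinal.{0}}
    (h : HasPosHomog n S c.ord) (hc : ℵ₀ < c) (hreg : c.IsRegular) (hS : S ⊆ Set.Iio c.ord)
    (hrefl : ∀ H A w psi, PiPos n H c.ord → (∀ xi ∈ H, xi ≠ 0 → IsSuccLimit xi) →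
      A ⊆ Vrank c.ord → (∀ xi ∈ H, ∀ i, w xi i ⊆ Vrank xi) → IsCoherent H A w →
      IsSigmaForm m psi → SOSat (Vrank c.ord) A psi (fun _ => ∅) (limitPred H w) →
      ∃ xi ∈ H, xi ≠ 0 ∧ SOSat (Vrank xi) (A ∩ Vrank xi) psi (fun _ => ∅) (w xi)) :
    PiIndesc (m + 1) S c.ord := by
  refine ⟨hS, fun A hA phi hphi hsat => ?_⟩
  by_contra! hfail
  obtain ⟨psi, k, hpsi, hblock⟩ := hphi.exists_block
  have hex (xi : Ordinal.{0}) : ∃ w, xi ∈ S → Extends (Vrank xi) k (fun _ => ∅) w ∧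
      ¬ SOSat (Vrank xi) (A ∩ Vrank xi) psi (fun _ => ∅) w := by
    by_cases hxi : xi ∈ S
    · have := hfail xi hxi
      rw [SOSatS, hblock] at this
      push Not at this
      exact this.imp fun w hw _ => hw
    · exact ⟨fun _ => ∅, fun h => absurd h hxi⟩
  choose w hw using hex
  obtain ⟨H, hHS, hpos, hlim, hcoh⟩ := h.exists_coherent hc hreg A w
  have hsub : ∀ xi ∈ H, ∀ i, w xi i ⊆ Vrank xi := fun xi hxi =>
    (hw xi (hHS hxi)).1.subset fun _ => Set.empty_subset _
  have hext : Extends (Vrank c.ord) k (fun _ => ∅) (limitPred H w) := by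
    refine ⟨fun i => ?_, fun i _ => ?_⟩
    · ext x
      simp only [limitPred, Set.mem_ofPred_eq, Set.mem_empty_iff_false, iff_false]
      rintro ⟨xi, hxi, -, hx⟩
      rw [(hw xi (hHS hxi)).1.1] at hx
      exact hx
    · rintro x ⟨xi, hxi, -, hx⟩
      exact Vrank_mono (le_of_lt (hpos.subset hxi)) (hsub xi hxi i hx)
  obtain ⟨xi, hxi, -, hs⟩ := hrefl H A w psi hpos hlim hA hsub hcoh hpsi
    ((hblock _ _ _ _).1 hsat _ hext)
  exact (hw xi (hHS hxi)).2 hs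

/-- Baumgartner. For `n ∈ {-1} ∪ ω`, if every `S`-list has a homogeneous
set which is `Π¹ₙ`-indescribable in `κ` (where `Π¹₋₁`-indescribable means of cardinality
`κ`), then `S` is `Π¹_{n+2}`-indescribable in `κ`. -/
theorem pi_indescribable_of_homogeneous (n : ℤ) (hn : -1 ≤ n)
    (kappa : Ordinal.{0}) (hreg : RegUncountable kappa)
    (S : Set Ordinal.{0}) (hS : S ⊆ Set.Iio kappa)
    (h : ∀ L : Ordinal.{0} → Set Ordinal.{0}, (∀ alpha ∈ S, L alpha ⊆ Set.Iio alpha) →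
      ∃ H, H ⊆ S ∧ PiPos n H kappa ∧ Homog L H) :
    PiPos (n + 2) S kappa := by
  obtain ⟨c, rfl⟩ : ∃ c : Cardinal.{0}, kappa = c.ord := ⟨_, hreg.2.symm⟩
  have hc : ℵ₀ < c := by
    rw [← Cardinal.ord_lt_ord, Cardinal.ord_aleph0]
    exact hreg.1
  have hcreg : c.IsRegular := ⟨hc.le, (Cardinal.ord_injective hreg.2).ge⟩
  replace h : HasPosHomog n S c.ord := h
  obtain ⟨m, rfl⟩ | rfl : (∃ m : ℕ, n = Int.ofNat m) ∨ n = -1 := by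
    rcases hn.eq_or_lt with hn | hn
    · exact .inr hn.symm
    · exact .inl (Int.eq_ofNat_of_zero_le (by omega))
  · refine h.piIndesc (m := m + 1) hc hcreg hS
      fun H A w psi hpos hlim hA hw hcoh hpsi hsat => ?_
    obtain ⟨pi, k, hpi, hblock⟩ := hpsi.exists_block
    obtain ⟨w', hw', hs⟩ := (hblock _ _ _ _).1 hsat
    have hW (i : ℕ) : limitPred H w i ⊆ Vrank c.ord := by
      rintro x ⟨xi, hxi, -, hx⟩
      exact Vrank_mono (le_of_lt (hpos.subset hxi)) (hw xi hxi i hx)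
    obtain ⟨xi, hxi, h0, hs'⟩ := PiIndesc.exists_sat hpos (isSuccLimit_ord hc.le) hlim hA
      (hw'.subset hW) hpi hs
    refine ⟨xi, hxi, h0, (hblock _ _ _ _).2 ⟨_, ?_, hs'⟩⟩
    rw [← show (fun i => limitPred H w i ∩ Vrank xi) = w xi from
      funext (hcoh.limitPred_inter hw hxi h0)]
    exact hw'.inter
  · refine h.piIndesc (m := 0) hc hcreg hS
      fun H A w psi hpos _ _ hw hcoh hpsi hsat => ?_
    obtain ⟨xi, hxi, hlt⟩ := hpos.exists_gt hc.le (isSuccLimit_ord hc.le).bot_lt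
    cases hpsi with
    | fo hfo =>
      exact ⟨xi, hxi, hlt.ne_bot, (hcoh.sat_limit hw hpos.subset
        (fun gamma hg => hpos.exists_gt hc.le hg) hfo hxi hlt.ne_bot (l := [])
        (by simp)).2 hsat⟩

end LCI
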